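/- For all m, n ≥ 1, LE⁺_CN(K_{m+n}) ≥ LE⁺_CN(K_{m,n}). In particular, the complete bipartite graph K_{m,n} is not CNSL-hyperenergetic. -/

import Mathlib

set_option linter.unusedSectionVars false

open Matrix BigOperators Finset

namespace CNE

variable {V : Type*} [Fintype V]

/-- The common neighborhood matrix `CN(G)`. -/
noncomputable def cn [DecidableEq V] (G : SimpleGraph V) : Matrix V V ℝ :=
  Matrix.of fun i j => if i = j then 0 else (Nat.card (G.commonNeighbors i j) : ℝ)

/-- The common neighborhood row sum (diagonal) matrix `CNRS(G)`. -/
noncomputable def cnrs [DecidableEq V] (G : SimpleGraph V) : Matrix V V ℝ :=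
  Matrix.diagonal fun i => ∑ j, cn G i j

/-- The common neighborhood Laplacian matrix `CNL(G) = CNRS(G) - CN(G)`. -/
noncomputable def cnl [DecidableEq V] (G : SimpleGraph V) : Matrix V V ℝ :=
  cnrs G - cn G

/-- The common neighborhood signless Laplacian matrix `CNSL(G) = CNRS(G) + CN(G)`. -/
noncomputable def cnsl [DecidableEq V] (G : SimpleGraph V) : Matrix V V ℝ :=
  cnrs G + cn G

lemma cn_isHermitian [DecidableEq V] (G : SimpleGraph V) : (cn G).IsHermitian := by
  ext i j
  simp only [Matrix.conjTranspose_apply, cn, Matrix.of_apply, star_trivial]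
  rw [SimpleGraph.commonNeighbors_symm]
  by_cases h : i = j
  · simp [h]
  · rw [if_neg h, if_neg fun hji => h hji.symm]

lemma cnrs_isHermitian [DecidableEq V] (G : SimpleGraph V) : (cnrs G).IsHermitian :=
  Matrix.isHermitian_diagonal _

lemma cnl_isHermitian [DecidableEq V] (G : SimpleGraph V) : (cnl G).IsHermitian :=
  (cnrs_isHermitian G).sub (cn_isHermitian G)

lemma cnsl_isHermitian [DecidableEq V] (G : SimpleGraph V) : (cnsl G).IsHermitian :=
  (cnrs_isHermitian G).add (cn_isHermitian G)

/-- The common neighborhood energy `E_CN(G)`: the sum of the absolute values of the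
eigenvalues (with multiplicity) of `CN(G)`. -/
noncomputable def Ecn [DecidableEq V] (G : SimpleGraph V) : ℝ :=
  ∑ i, |(cn_isHermitian G).eigenvalues i|

/-- The common neighborhood Laplacian energy `LE_CN(G)`. -/
noncomputable def LEcn [DecidableEq V] (G : SimpleGraph V) : ℝ :=
  ∑ i, |(cnl_isHermitian G).eigenvalues i - (cnrs G).trace / (Fintype.card V : ℝ)|

/-- The common neighborhood signless Laplacian energy `LE⁺_CN(G)`. -/
noncomputable def LEpcn [DecidableEq V] (G : SimpleGraph V) : ℝ :=
  ∑ i, |(cnsl_isHermitian G).eigenvalues i - (cnrs G).trace / (Fintype.card V : ℝ)|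

open Classical in
/-- The (real) adjacency matrix of a graph, defined classically. -/
noncomputable def adjMat (G : SimpleGraph V) : Matrix V V ℝ :=
  Matrix.of fun i j => if G.Adj i j then 1 else 0

lemma adjMat_isHermitian (G : SimpleGraph V) : (adjMat G).IsHermitian := by
  ext i j
  simp only [Matrix.conjTranspose_apply, adjMat, Matrix.of_apply, star_trivial]
  by_cases h : G.Adj i j
  · simp [h, h.symm]
  · have h' : ¬ G.Adj j i := fun hji => h hji.symm
    simp [h, h']

/-- The diagonal degree matrix of a graph. -/
noncomputable def degMat [DecidableEq V] (G : SimpleGraph V) : Matrix V V ℝ :=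
  Matrix.diagonal fun v => (Nat.card (G.neighborSet v) : ℝ)

/-- The Laplacian matrix `L(G) = D(G) - A(G)`. -/
noncomputable def lap [DecidableEq V] (G : SimpleGraph V) : Matrix V V ℝ :=
  degMat G - adjMat G

/-- The signless Laplacian matrix `Q(G) = D(G) + A(G)`. -/
noncomputable def slap [DecidableEq V] (G : SimpleGraph V) : Matrix V V ℝ :=
  degMat G + adjMat G

lemma degMat_isHermitian [DecidableEq V] (G : SimpleGraph V) : (degMat G).IsHermitian :=
  Matrix.isHermitian_diagonal _

lemma lap_isHermitian [DecidableEq V] (G : SimpleGraph V) : (lap G).IsHermitian :=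
  (degMat_isHermitian G).sub (adjMat_isHermitian G)

lemma slap_isHermitian [DecidableEq V] (G : SimpleGraph V) : (slap G).IsHermitian :=
  (degMat_isHermitian G).add (adjMat_isHermitian G)

/-- The energy `E(G)` of a graph: the sum of the absolute values of the eigenvalues
(with multiplicity) of the adjacency matrix. -/
noncomputable def energy [DecidableEq V] (G : SimpleGraph V) : ℝ :=
  ∑ i, |(adjMat_isHermitian G).eigenvalues i|

/-- The Laplacian energy `LE(G)`. -/
noncomputable def LE [DecidableEq V] (G : SimpleGraph V) : ℝ :=
  ∑ i, |(lap_isHermitian G).eigenvalues i - (degMat G).trace / (Fintype.card V : ℝ)|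

/-- The signless Laplacian energy `LE⁺(G)`. -/
noncomputable def LEp [DecidableEq V] (G : SimpleGraph V) : ℝ :=
  ∑ i, |(slap_isHermitian G).eigenvalues i - (degMat G).trace / (Fintype.card V : ℝ)|

/-- The derived graph `G†`: two vertices are adjacent iff their distance in `G` is two. -/
def derivedGraph (G : SimpleGraph V) : SimpleGraph V where
  Adj u v := G.dist u v = 2
  symm := by
    constructor
    intro u v h
    rwa [SimpleGraph.dist_comm]
  loopless := by
    constructor
    intro v h
    simp [SimpleGraph.dist_self] at h

open Polynomial in
lemma aux_charpoly (k : ℕ) (hk : 1 ≤ k) (a b : ℝ) :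
    (Matrix.of fun i j : Fin k => if i = j then a + b else b).charpoly
      = (X - C a) ^ (k - 1) * (X - C (a + k * b)) := by
  have h : (Matrix.of fun i j : Fin k => if i = j then a + b else b)
      = vecMulVec (fun _ => b) (fun _ => 1) - scalar (Fin k) (-a) := by
    ext i j
    by_cases hij : i = j <;> simp [vecMulVec_apply, hij, add_comm]
  rw [h, charpoly_sub_scalar, charpoly_vecMulVec]
  obtain ⟨k, rfl⟩ : ∃ l, k = l + 1 := ⟨k - 1, by omega⟩
  simp [dotProduct, smul_eq_C_mul]
  ring

lemma aux_sum [DecidableEq V] {A : Matrix V V ℝ} (hA : A.IsHermitian) (f : ℝ → ℝ) :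
    ∑ i, f (hA.eigenvalues i) = (A.charpoly.roots.map f).sum := by
  rw [hA.roots_charpoly_eq_eigenvalues]
  simp

open Polynomial in
lemma aux_roots (k : ℕ) (a b : ℝ) :
    ((X - C a) ^ (k - 1) * (X - C b)).roots = Multiset.replicate (k - 1) a + {b} := by
  rw [roots_mul, roots_pow, roots_X_sub_C, roots_X_sub_C, Multiset.nsmul_singleton]
  exact mul_ne_zero (pow_ne_zero _ (X_sub_C_ne_zero a)) (X_sub_C_ne_zero b)

lemma cn_top (N : ℕ) (hN : 2 ≤ N) :
    cn (⊤ : SimpleGraph (Fin N)) = Matrix.of fun i j => if i = j then 0 else ((N : ℝ) - 2) := by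
  ext i j
  simp only [cn, Matrix.of_apply]
  split_ifs with h
  · rfl
  · rw [Nat.card_eq_fintype_card, SimpleGraph.card_commonNeighbors_top h, Fintype.card_fin,
      Nat.cast_sub hN]
    simp

lemma aux_rowsum (k : ℕ) (c : ℝ) (i : Fin k) :
    ∑ j : Fin k, (if i = j then 0 else c) = (k - 1) * c := by
  have : ∀ j : Fin k, (if i = j then 0 else c) = c - (if i = j then c else 0) := by
    intro j; split_ifs <;> simp
  simp_rw [this, Finset.sum_sub_distrib]
  simp
  ring

lemma LE_top (N : ℕ) (hN : 2 ≤ N) :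
    LEpcn (⊤ : SimpleGraph (Fin N)) = 2 * (N - 1) * (N - 2) := by
  have hr : cnrs (⊤ : SimpleGraph (Fin N)) =
      Matrix.diagonal fun _ => ((N : ℝ) - 1) * (N - 2) := by
    unfold cnrs
    rw [cn_top N hN]
    congr 1
    ext i
    simpa using aux_rowsum N ((N : ℝ) - 2) i
  have hs : cnsl (⊤ : SimpleGraph (Fin N)) = Matrix.of fun i j : Fin N =>
      if i = j then (((N : ℝ) - 2) * (N - 2)) + (N - 2) else ((N : ℝ) - 2) := by
    unfold cnsl
    rw [hr, cn_top N hN]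
    ext i j
    by_cases h : i = j
    · simp [h]; ring
    · simp [h]
  unfold LEpcn
  rw [aux_sum (cnsl_isHermitian _)
    (fun x => |x - (cnrs (⊤ : SimpleGraph (Fin N))).trace / (Fintype.card (Fin N) : ℝ)|),
    hs, aux_charpoly N (by omega), aux_roots, hr]
  have h2 : (2 : ℝ) ≤ N := by exact_mod_cast hN
  have h0 : (N : ℝ) ≠ 0 := by positivity
  simp only [Matrix.trace_diagonal, Finset.sum_const, Finset.card_univ, Fintype.card_fin,
    nsmul_eq_mul, mul_div_cancel_left₀ _ h0, Multiset.map_add, Multiset.map_replicate,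
    Multiset.map_singleton, Multiset.sum_add, Multiset.sum_replicate, Multiset.sum_singleton]
  rw [abs_of_nonpos, abs_of_nonneg, Nat.cast_sub (by omega)]
  · push_cast; ring
  · nlinarith
  · nlinarith

lemma cn_bip (m n : ℕ) :
    cn (completeBipartiteGraph (Fin m) (Fin n)) = fromBlocks
      (Matrix.of fun i j => if i = j then 0 else (n : ℝ)) 0 0
      (Matrix.of fun i j => if i = j then 0 else (m : ℝ)) := by
  have hl : ∀ i j : Fin m, (completeBipartiteGraph (Fin m) (Fin n)).commonNeighbors
      (Sum.inl i) (Sum.inl j) = Set.range Sum.inr := by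
    intro i j; ext x; cases x <;> simp [SimpleGraph.mem_commonNeighbors]
  have hr : ∀ i j : Fin n, (completeBipartiteGraph (Fin m) (Fin n)).commonNeighbors
      (Sum.inr i) (Sum.inr j) = Set.range Sum.inl := by
    intro i j; ext x; cases x <;> simp [SimpleGraph.mem_commonNeighbors]
  have h1 : ∀ (i : Fin m) (j : Fin n),
      (completeBipartiteGraph (Fin m) (Fin n)).commonNeighbors
      (Sum.inl i) (Sum.inr j) = ∅ := by
    intro i j; ext x; cases x <;> simp [SimpleGraph.mem_commonNeighbors]
  have h2 : ∀ (i : Fin m) (j : Fin n),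
      (completeBipartiteGraph (Fin m) (Fin n)).commonNeighbors
      (Sum.inr j) (Sum.inl i) = ∅ := by
    intro i j; ext x; cases x <;> simp [SimpleGraph.mem_commonNeighbors]
  ext i j
  rcases i with i | i <;> rcases j with j | j
  · simp only [cn, Matrix.of_apply, fromBlocks_apply₁₁, hl, Sum.inl.injEq]
    rw [Nat.card_range_of_injective Sum.inr_injective]
    simp
  · simp [cn, h1]
  · simp [cn, h2]
  · simp only [cn, Matrix.of_apply, fromBlocks_apply₂₂, hr, Sum.inr.injEq]
    rw [Nat.card_range_of_injective Sum.inl_injective]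
    simp

lemma LE_bip (m n : ℕ) (hm : 1 ≤ m) (hn : 1 ≤ n) :
    LEpcn (completeBipartiteGraph (Fin m) (Fin n)) =
      (m - 1) * (2 * n ^ 2 / (m + n)) + |(n * (m ^ 2 + m * n - 2 * n) / (m + n) : ℝ)|
      + ((n - 1) * (2 * m ^ 2 / (m + n)) + |(m * (n ^ 2 + m * n - 2 * m) / (m + n) : ℝ)|) := by
  have hr : cnrs (completeBipartiteGraph (Fin m) (Fin n)) =
      Matrix.diagonal (Sum.elim (fun _ => ((m : ℝ) - 1) * n) (fun _ => ((n : ℝ) - 1) * m)) := by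
    unfold cnrs
    rw [cn_bip]
    congr 1
    ext i
    rcases i with i | i
    · simpa using aux_rowsum m (n : ℝ) i
    · simpa using aux_rowsum n (m : ℝ) i
  have hs : cnsl (completeBipartiteGraph (Fin m) (Fin n)) = fromBlocks
      (Matrix.of fun i j => if i = j then ((m : ℝ) - 2) * n + n else (n : ℝ)) 0 0
      (Matrix.of fun i j => if i = j then ((n : ℝ) - 2) * m + m else (m : ℝ)) := by
    unfold cnsl
    rw [hr, cn_bip]
    ext i j
    rcases i with i | i <;> rcases j with j | j
    · by_cases h : i = j
      · simp [h]; ring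
      · simp [h]
    · simp
    · simp
    · by_cases h : i = j
      · simp [h]; ring
      · simp [h]
  have hm' : (1 : ℝ) ≤ m := by exact_mod_cast hm
  have hn' : (1 : ℝ) ≤ n := by exact_mod_cast hn
  have h0 : (m + n : ℝ) ≠ 0 := by positivity
  have ht : (cnrs (completeBipartiteGraph (Fin m) (Fin n))).trace /
      (Fintype.card (Fin m ⊕ Fin n) : ℝ) = m * n * (m + n - 2) / (m + n) := by
    rw [hr]
    simp [Matrix.trace_diagonal]
    field_simp
    ring
  unfold LEpcn
  rw [ht, aux_sum (cnsl_isHermitian _)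
    (fun x => |x - (m * n * (m + n - 2) / (m + n) : ℝ)|),
    hs, charpoly_fromBlocks_zero₁₂, aux_charpoly m hm, aux_charpoly n hn, Polynomial.roots_mul,
    aux_roots, aux_roots]
  · simp only [Multiset.map_add, Multiset.map_replicate,
      Multiset.map_singleton, Multiset.sum_add, Multiset.sum_replicate, Multiset.sum_singleton,
      nsmul_eq_mul, Nat.cast_sub hm, Nat.cast_sub hn, Nat.cast_one]
    have e1 : ((m : ℝ) - 2) * n - m * n * (m + n - 2) / (m + n) = -(2 * n ^ 2 / (m + n)) := by
      field_simp; ring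
    have e2 : ((n : ℝ) - 2) * m - m * n * (m + n - 2) / (m + n) = -(2 * m ^ 2 / (m + n)) := by
      field_simp; ring
    have e3 : ((m : ℝ) - 2) * n + m * n - m * n * (m + n - 2) / (m + n)
        = n * (m ^ 2 + m * n - 2 * n) / (m + n) := by
      field_simp; ring
    have e4 : ((n : ℝ) - 2) * m + n * m - m * n * (m + n - 2) / (m + n)
        = m * (n ^ 2 + m * n - 2 * m) / (m + n) := by
      field_simp; ring
    rw [e1, e2, e3, e4, abs_neg, abs_neg, abs_of_nonneg (a := (2 * n ^ 2 / (m + n) : ℝ)),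
      abs_of_nonneg (a := (2 * m ^ 2 / (m + n) : ℝ))] <;> positivity
  · exact mul_ne_zero
      (mul_ne_zero (pow_ne_zero _ (Polynomial.X_sub_C_ne_zero _)) (Polynomial.X_sub_C_ne_zero _))
      (mul_ne_zero (pow_ne_zero _ (Polynomial.X_sub_C_ne_zero _)) (Polynomial.X_sub_C_ne_zero _))

lemma aux_ineq_one (n : ℕ) (hn : 1 ≤ n) :
    (2 * (n - 1) + |(n * (1 - n) : ℝ)| + |(n ^ 2 + n - 2 : ℝ)|)
      ≤ 2 * n * (n - 1) * (1 + n) := by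
  rcases hn.eq_or_lt with rfl | h
  · norm_num
  · have h' : (2 : ℝ) ≤ n := by exact_mod_cast h
    rw [abs_of_nonpos (by nlinarith), abs_of_nonneg (by nlinarith)]
    nlinarith [mul_nonneg (sub_nonneg.2 h') (sub_nonneg.2 h'),
      mul_nonneg (mul_nonneg (sub_nonneg.2 h') (sub_nonneg.2 h')) (sub_nonneg.2 h')]

lemma aux_ineq (m n : ℕ) (hm : 1 ≤ m) (hn : 1 ≤ n) :
    (m - 1) * (2 * n ^ 2) + |(n * (m ^ 2 + m * n - 2 * n) : ℝ)|
      + ((n - 1) * (2 * m ^ 2) + |(m * (n ^ 2 + m * n - 2 * m) : ℝ)|)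
      ≤ 2 * (m + n - 1) * (m + n - 2) * (m + n) := by
  rcases hm.eq_or_lt with rfl | hm2
  · have := aux_ineq_one n hn
    push_cast
    have e1 : (n * ((1 : ℝ) ^ 2 + 1 * n - 2 * n)) = n * (1 - n) := by ring
    have e2 : (1 * ((n : ℝ) ^ 2 + 1 * n - 2 * 1)) = n ^ 2 + n - 2 := by ring
    rw [e1, e2]
    linarith
  rcases hn.eq_or_lt with rfl | hn2
  · have := aux_ineq_one m hm
    push_cast
    have e1 : (m * ((1 : ℝ) ^ 2 + m * 1 - 2 * m)) = m * (1 - m) := by ring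
    have e2 : (1 * ((m : ℝ) ^ 2 + m * 1 - 2 * 1)) = m ^ 2 + m - 2 := by ring
    rw [e1, e2]
    linarith
  have h1 : (2 : ℝ) ≤ m := by exact_mod_cast hm2
  have h2 : (2 : ℝ) ≤ n := by exact_mod_cast hn2
  rw [abs_of_nonneg, abs_of_nonneg]
  · have h3 : (4 * m * n : ℝ) ≤ (m + n) ^ 2 := by nlinarith [sq_nonneg ((m : ℝ) - n)]
    have h4 : (4 * m * n : ℝ) * (m + n) ≤ (m + n) ^ 2 * (m + n) := by gcongr
    have h5 : 0 ≤ ((m : ℝ) + n) * (m + n - 2) ^ 2 := by positivity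
    nlinarith [sq_nonneg ((m : ℝ) - n)]
  · apply mul_nonneg <;> nlinarith
  · apply mul_nonneg <;> nlinarith

theorem statement7 (m n : ℕ) (hm : 1 ≤ m) (hn : 1 ≤ n) :
    LEpcn (completeBipartiteGraph (Fin m) (Fin n)) ≤ LEpcn (⊤ : SimpleGraph (Fin (m + n))) ∧
    ¬ LEpcn (⊤ : SimpleGraph (Fin (m + n))) <
        LEpcn (completeBipartiteGraph (Fin m) (Fin n)) := by
  rw [not_lt, and_self, LE_top (m + n) (by omega), LE_bip m n hm hn]
  have h0 : (0 : ℝ) < m + n := by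
    have : (1 : ℝ) ≤ m := by exact_mod_cast hm
    positivity
  rw [abs_div, abs_div, abs_of_pos h0, mul_div_assoc', mul_div_assoc', ← add_div, ← add_div,
    ← add_div, div_le_iff₀ h0]
  push_cast
  exact aux_ineq m n hm hn

end CNE
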